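/- arXiv:2310.11283 — 4 statements merged into one kernel-verified Lean document; each statement's English description precedes it below -/
import Mathlib

section
/- Let G be a connected finite simple graph and let S ⊆ V(G) be such that the induced subgraph G[S] is connected and geodesic in G, i.e., for all u,v ∈ S the distance between u and v in G[S] equals dist_G(u,v). Let 𝒞 be the set of connected components of G − S and let X ⊆ 𝒞 be any subset of these components. Then the induced subgraph G' = G[S ∪ ⋃_{C∈X} V(C)] is a geodesic subgraph of G: for all vertices a,b of G', the distance between a and b in G' equals dist_G(a,b). -/
open SimpleGraph

/-- The union of the vertex sets of a collection `X` of connected components of `G − S`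
(the subgraph of `G` induced on the complement of `S`). -/
def compUnion {V : Type*} (G : SimpleGraph V) (S : Set V)
    (X : Set ((G.induce (Sᶜ : Set V)).ConnectedComponent)) : Set V :=
  {v | ∃ h : v ∈ (Sᶜ : Set V), (G.induce (Sᶜ : Set V)).connectedComponentMk ⟨v, h⟩ ∈ X}

/-- A vertex of `S ∪ compUnion G S X` with a neighbour outside of this set lies in `S`. -/
theorem mem_of_adj_of_notMem_compUnion {V : Type*} {G : SimpleGraph V} {S : Set V}
    {X : Set ((G.induce (Sᶜ : Set V)).ConnectedComponent)} {u v : V}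
    (hu : u ∈ S ∪ compUnion G S X) (hv : v ∉ S ∪ compUnion G S X) (huv : G.Adj u v) :
    u ∈ S := by
  rcases hu with hu | ⟨hu, huX⟩
  · exact hu
  · refine absurd (Or.inr ?_) hv
    have hvS : v ∈ Sᶜ := fun h => hv (Or.inl h)
    have hadj : (G.induce (Sᶜ : Set V)).Adj ⟨u, hu⟩ ⟨v, hvS⟩ := huv
    exact ⟨hvS, ConnectedComponent.sound hadj.reachable ▸ huX⟩

/-- Every walk ending in `S ∪ compUnion G S X` can be replaced by one inside this set that is not
longer; if it starts outside, one first prepends a shortest walk from a vertex of `S`. -/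
theorem exists_walk_induce_compUnion_length_le {V : Type*} {G : SimpleGraph V} (hG : G.Connected)
    {S : Set V} (hSconn : (G.induce S).Connected)
    (hSgeo : ∀ u v : S, (G.induce S).dist u v = G.dist (u : V) (v : V))
    (X : Set ((G.induce (Sᶜ : Set V)).ConnectedComponent)) {a b : V} (p : G.Walk a b)
    (hb : b ∈ S ∪ compUnion G S X) :
    (∀ ha : a ∈ S ∪ compUnion G S X,
      ∃ q : (G.induce (S ∪ compUnion G S X)).Walk ⟨a, ha⟩ ⟨b, hb⟩, q.length ≤ p.length) ∧
    (a ∉ S ∪ compUnion G S X → ∀ (s : V) (hs : s ∈ S),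
      ∃ q : (G.induce (S ∪ compUnion G S X)).Walk ⟨s, Or.inl hs⟩ ⟨b, hb⟩,
        q.length ≤ G.dist s a + p.length) := by
  induction p with
  | nil => exact ⟨fun _ => ⟨.nil, le_rfl⟩, fun ha => absurd hb ha⟩
  | @cons a c b hac p ih =>
    obtain ⟨ih_mem, ih_notMem⟩ := ih hb
    refine ⟨fun ha => ?_, fun ha s hs => ?_⟩ <;> by_cases hc : c ∈ S ∪ compUnion G S X
    · obtain ⟨q, hq⟩ := ih_mem hc
      have hadj : (G.induce (S ∪ compUnion G S X)).Adj ⟨a, ha⟩ ⟨c, hc⟩ := hac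
      exact ⟨.cons hadj q, by simpa using hq⟩
    · obtain ⟨q, hq⟩ := ih_notMem hc a (mem_of_adj_of_notMem_compUnion ha hc hac)
      refine ⟨q, ?_⟩
      rw [dist_eq_one_iff_adj.mpr hac] at hq
      simpa [add_comm] using hq
    · have hcS := mem_of_adj_of_notMem_compUnion hc ha hac.symm
      obtain ⟨q, hq⟩ := ih_mem hc
      obtain ⟨r, hr⟩ := hSconn.exists_walk_length_eq_dist ⟨s, hs⟩ ⟨c, hcS⟩
      rw [hSgeo] at hr
      have htri := hG.dist_triangle (u := s) (v := a) (w := c)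
      rw [dist_eq_one_iff_adj.mpr hac] at htri
      let r' : (G.induce (S ∪ compUnion G S X)).Walk ⟨s, Or.inl hs⟩ ⟨c, hc⟩ :=
        r.map (G.induceHomOfLE Set.subset_union_left).toHom
      have hr' : r'.length = G.dist s c := (Walk.length_map _ r).trans hr
      refine ⟨r'.append q, ?_⟩
      rw [Walk.length_append, Walk.length_cons]
      omega
    · obtain ⟨q, hq⟩ := ih_notMem hc s hs
      have htri := hG.dist_triangle (u := s) (v := a) (w := c)
      rw [dist_eq_one_iff_adj.mpr hac] at htri
      refine ⟨q, ?_⟩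
      rw [Walk.length_cons]
      omega

/-- Let `G` be a connected finite graph and `S ⊆ V(G)` be such that `G[S]` is
connected and geodesic in `G`. Then for any subset `X` of the connected components of `G − S`,
the induced subgraph `G[S ∪ ⋃_{C ∈ X} V(C)]` is a geodesic subgraph of `G`. -/
theorem stmt_3 {V : Type*} [Fintype V] (G : SimpleGraph V) (hG : G.Connected)
    (S : Set V) (hSconn : (G.induce S).Connected)
    (hSgeo : ∀ u v : S, (G.induce S).dist u v = G.dist (u : V) (v : V))
    (X : Set ((G.induce (Sᶜ : Set V)).ConnectedComponent)) :
    ∀ a b : ↥(S ∪ compUnion G S X),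
      (G.induce (S ∪ compUnion G S X)).dist a b = G.dist (a : V) (b : V) := by
  intro a b
  obtain ⟨p, hp⟩ := hG.exists_walk_length_eq_dist (a : V) (b : V)
  obtain ⟨q, hq⟩ :=
    (exists_walk_induce_compUnion_length_le hG hSconn hSgeo X p b.2).1 a.2
  apply le_antisymm
  · exact (dist_le q).trans (hq.trans hp.le)
  · obtain ⟨r, hr⟩ := q.reachable.exists_walk_length_eq_dist
    rw [← hr, ← Walk.length_map (Embedding.induce _).toHom r]
    exact dist_le _
end

section
/- Let δ be a natural number, let G be a connected δ-slim finite simple graph, and let S ⊆ V(G) be such that the induced subgraph G[S] is connected and geodesic in G, i.e., for all u,v ∈ S the distance between u and v in G[S] equals dist_G(u,v). Let 𝒞 be the set of connected components of G − S and let X ⊆ 𝒞 be any subset of these components. Then the induced subgraph G[S ∪ ⋃_{C∈X} V(C)] is δ-slim. -/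
open SimpleGraph

/-- A graph is `δ`-slim if for every triangle of geodesics (shortest paths), every vertex of one
side is within distance `δ` of some vertex of the union of the other two sides. -/
def IsSlim {V : Type*} (G : SimpleGraph V) (δ : ℕ) : Prop :=
  ∀ (x y z : V) (P : G.Walk x y) (Q : G.Walk y z) (R : G.Walk z x),
    P.length = G.dist x y → Q.length = G.dist y z → R.length = G.dist z x →
    ∀ p ∈ P.support, ∃ q, (q ∈ Q.support ∨ q ∈ R.support) ∧ G.dist p q ≤ δ

theorem mem_of_adj_of_notMem {V : Type*} {G : SimpleGraph V} {S : Set V}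
    {X : Set ((G.induce (Sᶜ : Set V)).ConnectedComponent)} {u v : V} (h : G.Adj u v)
    (hu : u ∈ S ∪ compUnion G S X) (hv : v ∉ S ∪ compUnion G S X) : u ∈ S := by
  by_contra huS
  obtain ⟨hu', hX⟩ := hu.resolve_left huS
  have hvS : v ∈ Sᶜ := fun hvS => hv (Or.inl hvS)
  refine hv (Or.inr ⟨hvS, ?_⟩)
  have hadj : (G.induce (Sᶜ : Set V)).Adj ⟨u, hu'⟩ ⟨v, hvS⟩ := h
  rwa [← ConnectedComponent.sound hadj.reachable]

/-- A walk of `G` ending in `S ∪ compUnion G S X` can be rerouted, without getting longer, so that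
it stays in this set from its first vertex in the set on. -/
theorem exists_walk_induce_compUnion {V : Type*} {G : SimpleGraph V} {S : Set V}
    (hSconn : (G.induce S).Connected)
    (hSgeo : ∀ u v : S, (G.induce S).dist u v = G.dist (u : V) (v : V))
    (X : Set ((G.induce (Sᶜ : Set V)).ConnectedComponent)) {u v : V} (p : G.Walk u v)
    (hv : v ∈ S ∪ compUnion G S X) :
    (∀ hu : u ∈ S ∪ compUnion G S X,
      ∃ q : (G.induce (S ∪ compUnion G S X)).Walk ⟨u, hu⟩ ⟨v, hv⟩, q.length ≤ p.length) ∧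
    (u ∉ S ∪ compUnion G S X →
      ∃ (t : V) (ht : t ∈ S) (r : G.Walk u t)
        (q : (G.induce (S ∪ compUnion G S X)).Walk ⟨t, Or.inl ht⟩ ⟨v, hv⟩),
        r.length + q.length ≤ p.length) := by
  induction p with
  | nil => exact ⟨fun _ => ⟨.nil, le_rfl⟩, fun hu => absurd hv hu⟩
  | @cons u w v h p ih =>
    obtain ⟨ih_mem, ih_notMem⟩ := ih hv
    constructor
    · intro hu
      by_cases hw : w ∈ S ∪ compUnion G S X
      · obtain ⟨q, hq⟩ := ih_mem hw
        have hadj : (G.induce (S ∪ compUnion G S X)).Adj ⟨u, hu⟩ ⟨w, hw⟩ := h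
        exact ⟨.cons hadj q, by simpa using hq⟩
      · obtain ⟨t, ht, r, q, hq⟩ := ih_notMem hw
        have huS := mem_of_adj_of_notMem h hu hw
        obtain ⟨s, hs⟩ := hSconn.exists_walk_length_eq_dist ⟨u, huS⟩ ⟨t, ht⟩
        have hle : s.length ≤ r.length + 1 := by
          rw [hs, hSgeo]
          exact dist_le (Walk.cons h r)
        obtain ⟨s', hs'⟩ : ∃ s' : (G.induce (S ∪ compUnion G S X)).Walk ⟨u, hu⟩ ⟨t, Or.inl ht⟩,
            s'.length = s.length :=
          ⟨s.map (induceHomOfLE G Set.subset_union_left).toHom, Walk.length_map _ s⟩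
        refine ⟨s'.append q, ?_⟩
        rw [Walk.length_append, Walk.length_cons]
        omega
    · intro hu
      by_cases hw : w ∈ S ∪ compUnion G S X
      · obtain ⟨q, hq⟩ := ih_mem hw
        refine ⟨w, mem_of_adj_of_notMem h.symm hw hu, .cons h .nil, q, ?_⟩
        simp only [Walk.length_cons, Walk.length_nil]
        omega
      · obtain ⟨t, ht, r, q, hq⟩ := ih_notMem hw
        refine ⟨t, ht, .cons h r, q, ?_⟩
        simp only [Walk.length_cons]
        omega

theorem dist_induce_compUnion {V : Type*} {G : SimpleGraph V} (hG : G.Connected) {S : Set V}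
    (hSconn : (G.induce S).Connected)
    (hSgeo : ∀ u v : S, (G.induce S).dist u v = G.dist (u : V) (v : V))
    (X : Set ((G.induce (Sᶜ : Set V)).ConnectedComponent))
    (u v : ↥(S ∪ compUnion G S X)) :
    (G.induce (S ∪ compUnion G S X)).dist u v = G.dist (u : V) (v : V) := by
  obtain ⟨p, hp⟩ := hG.exists_walk_length_eq_dist (u : V) (v : V)
  obtain ⟨q, hq⟩ := (exists_walk_induce_compUnion hSconn hSgeo X p v.2).1 u.2
  refine le_antisymm ((dist_le q).trans (hq.trans hp.le)) ?_
  obtain ⟨r, hr⟩ := q.reachable.exists_walk_length_eq_dist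
  rw [← hr, ← Walk.length_map (Embedding.induce (S ∪ compUnion G S X)).toHom r]
  exact dist_le _

/-- An induced subgraph that preserves distances inherits slimness. -/
theorem IsSlim.induce {V : Type*} {G : SimpleGraph V} {δ : ℕ} (hslim : IsSlim G δ) {W : Set V}
    (hW : ∀ u v : W, (G.induce W).dist u v = G.dist (u : V) (v : V)) :
    IsSlim (G.induce W) δ := by
  intro x y z P Q R hP hQ hR p hp
  let f := (Embedding.induce (G := G) W).toHom
  obtain ⟨q, hq, hd⟩ := hslim (f x) (f y) (f z) (P.map f) (Q.map f) (R.map f)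
    ((Walk.length_map f P).trans (hP.trans (hW x y)))
    ((Walk.length_map f Q).trans (hQ.trans (hW y z)))
    ((Walk.length_map f R).trans (hR.trans (hW z x)))
    (f p) (by rw [Walk.support_map]; exact List.mem_map_of_mem hp)
  rw [Walk.support_map, Walk.support_map, List.mem_map, List.mem_map] at hq
  rcases hq with ⟨q, hq, rfl⟩ | ⟨q, hq, rfl⟩
  · exact ⟨q, Or.inl hq, (hW p q).trans_le hd⟩
  · exact ⟨q, Or.inr hq, (hW p q).trans_le hd⟩

/-- Let `G` be a connected `δ`-slim finite graph and `S ⊆ V(G)` be such that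
`G[S]` is connected and geodesic in `G`. Then for any subset `X` of the connected components of
`G − S`, the induced subgraph `G[S ∪ ⋃_{C ∈ X} V(C)]` is `δ`-slim. -/
theorem stmt_4 {V : Type*} [Fintype V] (G : SimpleGraph V) (hG : G.Connected)
    (δ : ℕ) (hslim : IsSlim G δ)
    (S : Set V) (hSconn : (G.induce S).Connected)
    (hSgeo : ∀ u v : S, (G.induce S).dist u v = G.dist (u : V) (v : V))
    (X : Set ((G.induce (Sᶜ : Set V)).ConnectedComponent)) :
    IsSlim (G.induce (S ∪ compUnion G S X)) δ := by
  exact hslim.induce (dist_induce_compUnion hG hSconn hSgeo X)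
end

section
/- Let T be a finite tree with at least one edge in which every vertex has degree at most 3, and let w : V(T) → ℝ≥0 be a weight function with total weight W = Σ_{v∈V(T)} w(v) and with w(v) ≤ m for every vertex v. Then there exists an edge e of T such that each of the two connected components of T − e has total weight at most (2/3)·W + m. -/
open SimpleGraph

attribute [local instance] Classical.propDecidable

theorem Finset.sum_biUnion_le_sum_sum {ι α : Type*} (s : Finset ι) (t : ι → Finset α)
    {f : α → ℝ} (hf : ∀ a, 0 ≤ f a) :
    ∑ a ∈ s.biUnion t, f a ≤ ∑ i ∈ s, ∑ a ∈ t i, f a := by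
  induction s using Finset.induction_on with
  | empty => simp
  | insert i s hi ih =>
    rw [Finset.biUnion_insert, Finset.sum_insert hi]
    have h := Finset.sum_union_inter (s₁ := t i) (s₂ := s.biUnion t) (f := f)
    have := Finset.sum_nonneg (s := t i ∩ s.biUnion t) (fun a _ => hf a)
    linarith

namespace SimpleGraph

variable {V : Type*} {T : SimpleGraph V} {u v x y : V}

/-- The vertices that can be reached from `v` without passing through `u`. -/
noncomputable def sideAvoiding [Fintype V] (T : SimpleGraph V) (u v : V) : Finset V :=
  Finset.univ.filter fun y => ∃ p : T.Walk v y, u ∉ p.support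

theorem mem_sideAvoiding [Fintype V] :
    y ∈ T.sideAvoiding u v ↔ ∃ p : T.Walk v y, u ∉ p.support := by
  simp [sideAvoiding]

theorem notMem_sideAvoiding_self [Fintype V] : u ∉ T.sideAvoiding u v := by
  rw [mem_sideAvoiding]
  rintro ⟨p, hp⟩
  exact hp p.end_mem_support

theorem self_mem_sideAvoiding [Fintype V] (h : u ≠ v) : v ∈ T.sideAvoiding u v :=
  mem_sideAvoiding.2 ⟨.nil, by simpa using h⟩

theorem reachable_deleteEdges_of_mem_sideAvoiding [Fintype V] (h : y ∈ T.sideAvoiding u v) :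
    (T.deleteEdges {s(u, v)}).Reachable v y := by
  obtain ⟨p, hp⟩ := mem_sideAvoiding.1 h
  exact ⟨p.toDeleteEdge s(u, v) fun he => hp (p.fst_mem_support_of_mem_edges he)⟩

theorem IsAcyclic.disjoint_sideAvoiding [Fintype V] (hT : T.IsAcyclic) (h : T.Adj u v) :
    Disjoint (T.sideAvoiding u v) (T.sideAvoiding v u) := by
  rw [Finset.disjoint_left]
  intro y hv hu
  have hu := reachable_deleteEdges_of_mem_sideAvoiding hu
  rw [Sym2.eq_swap] at hu
  exact isBridge_iff.1 (isAcyclic_iff_forall_adj_isBridge.1 hT h)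
    (hu.trans (reachable_deleteEdges_of_mem_sideAvoiding hv).symm)

theorem Connected.mem_sideAvoiding_or [Fintype V] (hT : T.Connected) (h : u ≠ v) (y : V) :
    y ∈ T.sideAvoiding u v ∨ y ∈ T.sideAvoiding v u := by
  obtain ⟨p, hp⟩ := (hT v y).exists_isPath
  by_cases hu : u ∈ p.support
  · refine .inr (mem_sideAvoiding.2 ⟨p.dropUntil u hu, fun hv => ?_⟩)
    have hn := hp.support_nodup
    rw [← p.take_spec hu, Walk.support_append, List.nodup_append] at hn
    rw [Walk.mem_support_iff] at hv
    exact hn.2.2 v (Walk.start_mem_support _) v (hv.resolve_left h.symm) rfl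
  · exact .inl (mem_sideAvoiding.2 ⟨p, hu⟩)

theorem connectedComponent_supp_subset_sideAvoiding_or [Fintype V] (hconn : T.Connected)
    (hacyc : T.IsAcyclic) (h : T.Adj u v) (C : (T.deleteEdges {s(u, v)}).ConnectedComponent) :
    C.supp ⊆ T.sideAvoiding u v ∨ C.supp ⊆ T.sideAvoiding v u := by
  have hbridge := isBridge_iff.1 (isAcyclic_iff_forall_adj_isBridge.1 hacyc h)
  have hswap {y : V} (hy : y ∈ T.sideAvoiding v u) :
      (T.deleteEdges {s(u, v)}).Reachable u y := by
    have := reachable_deleteEdges_of_mem_sideAvoiding hy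
    rwa [Sym2.eq_swap] at this
  induction C using ConnectedComponent.ind with | h y =>
  have hreach {z : V} (hz : z ∈ ((T.deleteEdges {s(u, v)}).connectedComponentMk y).supp) :
      (T.deleteEdges {s(u, v)}).Reachable z y :=
    ConnectedComponent.exact ((ConnectedComponent.mem_supp_iff _ _).1 hz)
  refine (hconn.mem_sideAvoiding_or h.ne y).imp (fun hy z hz => ?_) (fun hy z hz => ?_)
  · refine (hconn.mem_sideAvoiding_or h.ne z).resolve_right fun hzu => hbridge ?_
    exact ((hswap hzu).trans (hreach hz)).trans (reachable_deleteEdges_of_mem_sideAvoiding hy).symm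
  · refine (hconn.mem_sideAvoiding_or h.ne z).resolve_left fun hzv => hbridge ?_
    exact ((hswap hy).trans (hreach hz).symm).trans
      (reachable_deleteEdges_of_mem_sideAvoiding hzv).symm

theorem IsAcyclic.sideAvoiding_ssubset [Fintype V] (hT : T.IsAcyclic) (huv : T.Adj u v)
    (hvx : T.Adj v x) (hxu : x ≠ u) : T.sideAvoiding v x ⊂ T.sideAvoiding u v := by
  refine (Finset.ssubset_iff_of_subset fun y hy => ?_).2
    ⟨v, self_mem_sideAvoiding huv.ne, notMem_sideAvoiding_self⟩
  obtain ⟨p, hp⟩ := mem_sideAvoiding.1 hy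
  refine mem_sideAvoiding.2 ⟨.cons hvx p, fun hu => ?_⟩
  rw [Walk.support_cons, List.mem_cons] at hu
  have hu := hu.resolve_left huv.ne
  have hx : x ∈ T.sideAvoiding u v :=
    mem_sideAvoiding.2 ⟨hvx.toWalk, by simp [huv.ne, hxu.symm]⟩
  refine Finset.disjoint_left.1 (hT.disjoint_sideAvoiding huv) hx
    (mem_sideAvoiding.2 ⟨(p.takeUntil u hu).reverse, fun hv => hp ?_⟩)
  rw [Walk.support_reverse, List.mem_reverse] at hv
  exact p.support_takeUntil_subset_support hu hv

theorem sideAvoiding_subset_insert_biUnion [Fintype V] :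
    T.sideAvoiding u v ⊆
      insert v (((T.neighborFinset v).erase u).biUnion fun x => T.sideAvoiding v x) := by
  intro y hy
  obtain ⟨p, hp⟩ := mem_sideAvoiding.1 hy
  have hq := p.bypass_isPath
  have hqu : u ∉ p.bypass.support := fun h => hp (p.support_bypass_subset_support h)
  generalize p.bypass = q at hq hqu
  cases q with
  | nil => simp
  | @cons _ x _ hvx q =>
    rw [Walk.cons_isPath_iff] at hq
    refine Finset.mem_insert_of_mem (Finset.mem_biUnion.2 ⟨x, ?_, mem_sideAvoiding.2 ⟨q, hq.2⟩⟩)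
    rw [Finset.mem_erase, mem_neighborFinset]
    refine ⟨?_, hvx⟩
    rintro rfl
    simp at hqu

end SimpleGraph

/-- In a finite tree `T` of maximum degree at most 3 with at least one edge,
with nonnegative vertex weights `w` bounded by `m` and total weight `W`, there is an edge `e`
such that each connected component of `T − e` has total weight at most `(2/3)·W + m`. -/
theorem stmt_10 {V : Type*} [Fintype V] (T : SimpleGraph V)
    (hconn : T.Connected) (hacyc : T.IsAcyclic) (hedge : T.edgeSet.Nonempty)
    (hdeg : ∀ v : V, T.degree v ≤ 3)
    (w : V → ℝ) (hw : ∀ v, 0 ≤ w v) (m : ℝ) (hm : ∀ v, w v ≤ m) :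
    ∃ e ∈ T.edgeSet, ∀ C : (T.deleteEdges {e}).ConnectedComponent,
      ∑ v ∈ Finset.univ.filter (fun v => v ∈ C.supp), w v
        ≤ (2/3 : ℝ) * (∑ v, w v) + m := by
  by_contra! hheavy
  set W := ∑ v, w v with hW
  have hor {u v : V} (h : T.Adj u v) :
      2 / 3 * W + m < ∑ y ∈ T.sideAvoiding u v, w y ∨
        2 / 3 * W + m < ∑ y ∈ T.sideAvoiding v u, w y := by
    obtain ⟨C, hC⟩ := hheavy s(u, v) h
    refine (connectedComponent_supp_subset_sideAvoiding_or hconn hacyc h C).imp ?_ ?_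
    all_goals
      refine fun hsub => hC.trans_le
        (Finset.sum_le_sum_of_subset_of_nonneg (fun y hy => ?_) fun y _ _ => hw y)
      exact hsub (Finset.mem_filter.1 hy).2
  have hWnonneg : 0 ≤ W := Finset.sum_nonneg fun v _ => hw v
  have hlight (n : ℕ) : ∀ u v, T.Adj u v → (T.sideAvoiding u v).card = n →
      ∑ y ∈ T.sideAvoiding u v, w y ≤ 2 / 3 * W + m := by
    induction n using Nat.strong_induction_on with | _ n ih =>
    rintro u v huv rfl
    have hthird : ∀ x ∈ (T.neighborFinset v).erase u,
        ∑ y ∈ T.sideAvoiding v x, w y ≤ W / 3 := by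
      intro x hx
      rw [Finset.mem_erase, mem_neighborFinset] at hx
      have hsmall := ih _ (Finset.card_lt_card (hacyc.sideAvoiding_ssubset huv hx.2 hx.1))
        v x hx.2 rfl
      have hbig := (hor hx.2).resolve_left hsmall.not_gt
      have hsum : ∑ y ∈ T.sideAvoiding v x, w y + ∑ y ∈ T.sideAvoiding x v, w y ≤ W := by
        rw [← Finset.sum_union (hacyc.disjoint_sideAvoiding hx.2)]
        exact Finset.sum_le_sum_of_subset_of_nonneg (Finset.subset_univ _) fun y _ _ => hw y
      linarith [hw v, hm v]
    have hcard : ((T.neighborFinset v).erase u).card ≤ 2 := by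
      rw [Finset.card_erase_of_mem (by simpa using huv.symm), card_neighborFinset_eq_degree]
      have := hdeg v
      omega
    calc
      _ ≤ ∑ y ∈ insert v (((T.neighborFinset v).erase u).biUnion fun x => T.sideAvoiding v x),
          w y := Finset.sum_le_sum_of_subset_of_nonneg sideAvoiding_subset_insert_biUnion
            fun y _ _ => hw y
      _ ≤ w v + ∑ y ∈ ((T.neighborFinset v).erase u).biUnion fun x => T.sideAvoiding v x,
          w y := by
        rw [Finset.sum_insert]
        simp [notMem_sideAvoiding_self]
      _ ≤ m + ((T.neighborFinset v).erase u).card • (W / 3) :=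
        add_le_add (hm v) ((Finset.sum_biUnion_le_sum_sum _ _ hw).trans
          (Finset.sum_le_card_nsmul _ _ _ hthird))
      _ ≤ m + 2 • (W / 3) := by gcongr
      _ = 2 / 3 * W + m := by ring
  obtain ⟨e, he⟩ := hedge
  induction e with | _ u v =>
  exact (hor he).elim (hlight _ u v he rfl).not_gt (hlight _ v u he.symm rfl).not_gt
end

section
/- Let Π be a property of finite simple graphs that is hereditary (every induced subgraph of a graph with property Π has property Π), determined by the components (any disjoint union of graphs having property Π has property Π), and holds for the one-vertex graph. Let c ∈ ℕ, let G be an n-vertex graph that admits a proper vertex coloring with c colors, let m be the maximum size of a set S ⊆ V(G) such that G[S] has property Π, and let B ⊆ V(G) with |B| ≤ β·n for some real β ≥ 0 with c·β ≤ 1. Then there exists a set S ⊆ V(G) ∖ B such that G[S] has property Π and |S| ≥ (1 − c·β)·m. -/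
open SimpleGraph

/-- The disjoint union of an indexed family of graphs, as a graph on the sigma type. -/
def sigmaGraph {ι : Type} (Vf : ι → Type) (Gs : ∀ i, SimpleGraph (Vf i)) :
    SimpleGraph (Σ i, Vf i) :=
  SimpleGraph.fromRel
    (fun x y => ∃ (i : ι) (a b : Vf i), (Gs i).Adj a b ∧ x = ⟨i, a⟩ ∧ y = ⟨i, b⟩)

/-- A component-determined property that holds for the one-vertex graph holds for every
edgeless graph. -/
theorem property_of_forall_not_adj (Pi' : ∀ V : Type, SimpleGraph V → Prop)
    (hiso : ∀ (V W : Type) (G : SimpleGraph V) (H : SimpleGraph W),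
      Nonempty (G ≃g H) → Pi' V G → Pi' W H)
    (hcomp : ∀ (ι : Type) (Vf : ι → Type) (Gs : ∀ i, SimpleGraph (Vf i)),
      (∀ i, Pi' (Vf i) (Gs i)) → Pi' (Σ i, Vf i) (sigmaGraph Vf Gs))
    (hone : Pi' (Fin 1) ⊥) {V : Type} (G : SimpleGraph V) (hG : ∀ v w, ¬ G.Adj v w) :
    Pi' V G := by
  refine hiso _ _ _ _ ⟨⟨Equiv.sigmaUnique V fun _ => Fin 1, ?_⟩⟩
    (hcomp V (fun _ => Fin 1) (fun _ => ⊥) fun _ => hone)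
  intro a b
  simp [hG, sigmaGraph]

/-- A hereditary property passes from an induced subgraph to a smaller induced subgraph. -/
theorem property_induce_mono (Pi' : ∀ V : Type, SimpleGraph V → Prop)
    (hiso : ∀ (V W : Type) (G : SimpleGraph V) (H : SimpleGraph W),
      Nonempty (G ≃g H) → Pi' V G → Pi' W H)
    (hhered : ∀ (V : Type) (G : SimpleGraph V) (s : Set V), Pi' V G → Pi' ↥s (G.induce s))
    {V : Type} (G : SimpleGraph V) {S T : Set V} (hST : S ⊆ T) (hT : Pi' ↥T (G.induce T)) :
    Pi' ↥S (G.induce S) := by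
  refine hiso _ _ _ _ ⟨⟨⟨fun x => ⟨x.1.1, x.2⟩, fun x => ⟨⟨x.1, hST x.2⟩, x.2⟩,
    fun _ => rfl, fun _ => rfl⟩, ?_⟩⟩ (hhered _ _ {x : T | (x : V) ∈ S} hT)
  intro a b
  exact Iff.rfl

/-- If every color class of a coloring with `c` colors has at most `m` vertices, then the graph
has at most `c * m` vertices. -/
theorem card_le_mul_of_colorClass_ncard_le {V : Type} [Fintype V] {G : SimpleGraph V} {c m : ℕ}
    (C : G.Coloring (Fin c)) (h : ∀ i, (C.colorClass i).ncard ≤ m) :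
    Fintype.card V ≤ c * m := by
  classical
  have key := Finset.card_le_mul_card_image_of_maps_to (s := (Finset.univ : Finset V))
    (t := (Finset.univ : Finset (Fin c))) (f := C) (fun _ _ => Finset.mem_univ _) m
    (fun i _ => by
      rw [← Set.ncard_coe_finset]
      convert h i using 2
      ext v
      simp [SimpleGraph.Coloring.colorClass])
  simpa [mul_comm] using key

/-- Let `Pi'` be a graph property that is hereditary, determined by the
components, and holds for the one-vertex graph. If `G` is a `c`-colorable `n`-vertex graph, `m`
is the maximum size of a vertex set inducing a subgraph with property `Pi'`, and `B` is a set of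
at most `β·n` vertices with `c·β ≤ 1`, then there is a set `S ⊆ V ∖ B` inducing a subgraph with
property `Pi'` of size at least `(1 − c·β)·m`. -/
theorem stmt_13 (Pi' : ∀ V : Type, SimpleGraph V → Prop)
    (hiso : ∀ (V W : Type) (G : SimpleGraph V) (H : SimpleGraph W),
      Nonempty (G ≃g H) → Pi' V G → Pi' W H)
    (hhered : ∀ (V : Type) (G : SimpleGraph V) (s : Set V), Pi' V G → Pi' ↥s (G.induce s))
    (hcomp : ∀ (ι : Type) (Vf : ι → Type) (Gs : ∀ i, SimpleGraph (Vf i)),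
      (∀ i, Pi' (Vf i) (Gs i)) → Pi' (Σ i, Vf i) (sigmaGraph Vf Gs))
    (hone : Pi' (Fin 1) ⊥)
    (V : Type) [Fintype V] (G : SimpleGraph V)
    (c : ℕ) (hcol : G.Colorable c)
    (m : ℕ) (hm : IsGreatest {k : ℕ | ∃ S : Set V, Pi' ↥S (G.induce S) ∧ S.ncard = k} m)
    (B : Set V) (β : ℝ) (hβ0 : 0 ≤ β) (hB : (B.ncard : ℝ) ≤ β * Fintype.card V)
    (hcβ : (c : ℝ) * β ≤ 1) :
    ∃ S : Set V, S ⊆ Bᶜ ∧ Pi' ↥S (G.induce S) ∧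
      (1 - (c : ℝ) * β) * m ≤ (S.ncard : ℝ) := by
  obtain ⟨⟨T, hT, hTm⟩, hmax⟩ := hm
  obtain ⟨C⟩ := hcol
  have hn : Fintype.card V ≤ c * m := by
    refine card_le_mul_of_colorClass_ncard_le C fun i => hmax ⟨C.colorClass i, ?_, rfl⟩
    refine property_of_forall_not_adj Pi' hiso hcomp hone _ fun v w hvw => ?_
    exact C.valid hvw (v.2.trans w.2.symm)
  refine ⟨T \ B, fun _ hx => hx.2,
    property_induce_mono Pi' hiso hhered G Set.sdiff_subset hT, ?_⟩
  have hdiff : (m : ℝ) ≤ (T \ B).ncard + B.ncard := by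
    rw [← hTm]
    exact_mod_cast Set.ncard_le_ncard_sdiff_add_ncard T B
  have hn' : (Fintype.card V : ℝ) ≤ c * m := by exact_mod_cast hn
  have hβn := mul_le_mul_of_nonneg_left hn' hβ0
  linarith
end
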